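/- In R = U[[h]] (Jordanian deformation of sl(3)): 2h·(E₁E₂ - E₂E₁) = T² - 1, and the Serre relations E₁²E₂ - 2E₁E₂E₁ + E₂E₁² = 0 and E₂²E₁ - 2E₂E₁E₂ + E₁E₂² = 0 hold. -/

import Mathlib

noncomputable section

open LieAlgebra.SpecialLinear

attribute [local instance 100] LieRing.ofAssociativeRing

/-- The generalized binomial coefficient `α(α-1)⋯(α-n+1)/n!`. -/
def qbinom (α : ℚ) (n : ℕ) : ℚ :=
  (∏ i ∈ Finset.range n, (α - (i : ℚ))) / (n.factorial : ℚ)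

/-- `U(sl(3,ℂ))`, the universal enveloping algebra of `sl(3,ℂ)`. -/
abbrev Usl3 : Type := UniversalEnvelopingAlgebra ℂ (sl (Fin 3) ℂ)

namespace Usl3

/-- The canonical embedding `sl(3,ℂ) → U(sl(3,ℂ))`. -/
def ι : sl (Fin 3) ℂ →ₗ⁅ℂ⁆ Usl3 := UniversalEnvelopingAlgebra.ι ℂ

/-- `h₁`, the image of the matrix `E₁₁ - E₂₂`. -/
def h₁ : Usl3 := ι ⟨Matrix.single 0 0 1 - Matrix.single 1 1 1,
  show _ ∈ LinearMap.ker (Matrix.traceLinearMap (Fin 3) ℂ ℂ) by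
    simp [LinearMap.mem_ker, Matrix.trace_single_eq_same]⟩

/-- `h₂`, the image of the matrix `E₂₂ - E₃₃`. -/
def h₂ : Usl3 := ι ⟨Matrix.single 1 1 1 - Matrix.single 2 2 1,
  show _ ∈ LinearMap.ker (Matrix.traceLinearMap (Fin 3) ℂ ℂ) by
    simp [LinearMap.mem_ker, Matrix.trace_single_eq_same]⟩

/-- `e₁`, the image of the matrix `E₁₂`. -/
def e₁ : Usl3 := ι (single 0 1 (by decide) (1 : ℂ))

/-- `e₂`, the image of the matrix `E₂₃`. -/
def e₂ : Usl3 := ι (single 1 2 (by decide) (1 : ℂ))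

/-- `f₁`, the image of the matrix `E₂₁`. -/
def f₁ : Usl3 := ι (single 1 0 (by decide) (1 : ℂ))

/-- `f₂`, the image of the matrix `E₃₂`. -/
def f₂ : Usl3 := ι (single 2 1 (by decide) (1 : ℂ))

/-- `e₃ := e₁e₂ - e₂e₁`. -/
def e₃ : Usl3 := e₁ * e₂ - e₂ * e₁

/-- `f₃ := f₂f₁ - f₁f₂`. -/
def f₃ : Usl3 := f₂ * f₁ - f₁ * f₂

/-- `h₃ := h₁ + h₂`. -/
def h₃ : Usl3 := h₁ + h₂

/-- `S := Σ_{n≥0} binom(1/2,n) h^{2n} e₃^{2n}` in `R = U(sl(3,ℂ))[[h]]`. -/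
def S : PowerSeries Usl3 :=
  PowerSeries.mk fun m =>
    if m % 2 = 0 then ((qbinom (1/2) (m / 2) : ℚ) : ℂ) • e₃ ^ m else 0

/-- `T := h·e₃ + S`. -/
def T : PowerSeries Usl3 := PowerSeries.X * PowerSeries.C e₃ + S

/-- `T⁻¹ := -h·e₃ + S`. -/
def Tinv : PowerSeries Usl3 := -(PowerSeries.X * PowerSeries.C e₃) + S

/-- `Σ_{n≥0} binom(α,n)(T-1)ⁿ`, well defined since `T - 1` has zero constant term
(the degree-`m` coefficient only receives contributions from `n ≤ m`). -/
def Tpow (α : ℚ) : PowerSeries Usl3 :=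
  PowerSeries.mk fun m =>
    PowerSeries.coeff m
      (∑ n ∈ Finset.range (m + 1), ((qbinom α n : ℚ) : ℂ) • (T - 1) ^ n)

/-- `T^{1/2} := Σ_{n≥0} binom(1/2,n)(T-1)ⁿ`. -/
def Thalf : PowerSeries Usl3 := Tpow (1/2)

/-- `T^{-1/2} := Σ_{n≥0} binom(-1/2,n)(T-1)ⁿ`. -/
def Tneghalf : PowerSeries Usl3 := Tpow (-(1/2))

/-- `E₁ := T^{1/2}e₁`. -/
def E₁ : PowerSeries Usl3 := Thalf * PowerSeries.C e₁

/-- `E₂ := T^{1/2}e₂`. -/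
def E₂ : PowerSeries Usl3 := Thalf * PowerSeries.C e₂

/-- `H₃ := S·h₃`. -/
def H₃ : PowerSeries Usl3 := S * PowerSeries.C h₃

/-- `F₃ := f₃ - (h²/4)e₃(h₃² - 1)`. -/
def F₃ : PowerSeries Usl3 :=
  PowerSeries.C f₃ -
    (1/4 : ℂ) • (PowerSeries.X ^ 2 * PowerSeries.C (e₃ * (h₃ ^ 2 - 1)))

/-- `H₁ := h₁ - (h/2)e₃T⁻¹h₃`. -/
def H₁ : PowerSeries Usl3 :=
  PowerSeries.C h₁ -
    (1/2 : ℂ) • (PowerSeries.X * PowerSeries.C e₃ * Tinv * PowerSeries.C h₃)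

/-- `H₂ := h₂ - (h/2)e₃T⁻¹h₃`. -/
def H₂ : PowerSeries Usl3 :=
  PowerSeries.C h₂ -
    (1/2 : ℂ) • (PowerSeries.X * PowerSeries.C e₃ * Tinv * PowerSeries.C h₃)

/-- `F₁ := T^{-1/2}(f₁ + (h/2)e₂Th₃)`. -/
def F₁ : PowerSeries Usl3 :=
  Tneghalf * (PowerSeries.C f₁ +
    (1/2 : ℂ) • (PowerSeries.X * PowerSeries.C e₂ * T * PowerSeries.C h₃))

/-- `F₂ := T^{-1/2}(f₂ - (h/2)e₁Th₃)`. -/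
def F₂ : PowerSeries Usl3 :=
  Tneghalf * (PowerSeries.C f₂ -
    (1/2 : ℂ) • (PowerSeries.X * PowerSeries.C e₁ * T * PowerSeries.C h₃))

end Usl3

theorem qbinom_eq_choose (α : ℚ) (n : ℕ) : qbinom α n = Ring.choose α n := by
  rw [qbinom, ← descPochhammer_eval_eq_prod_range, div_eq_iff (by positivity)]
  have h := Ring.descPochhammer_eq_factorial_smul_choose α n
  rw [nsmul_eq_mul] at h
  rw [mul_comm, ← h, ← descPochhammer_map (Int.castRingHom ℚ), Polynomial.eval_map,
    Polynomial.eval₂_eq_sum, Polynomial.smeval_eq_sum]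
  simp [Polynomial.sum_def, Polynomial.smul_pow]

open Polynomial in
theorem X_pow_dvd_sq_sum_qbinom_half (N : ℕ) :
    (X : ℂ[X]) ^ N ∣
      (∑ n ∈ Finset.range N, monomial n ((qbinom (1/2) n : ℚ) : ℂ)) ^ 2 - (1 + X) := by
  set B : PowerSeries ℂ := PowerSeries.binomialSeries ℂ (1/2 : ℚ) with hB
  have hsq : B * B = 1 + PowerSeries.X := by
    rw [hB, ← PowerSeries.binomialSeries_add]
    have := PowerSeries.binomialSeries_nat (R := ℚ) (A := ℂ) 1
    norm_num at this ⊢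
    exact this
  have htrunc : ∑ n ∈ Finset.range N, monomial n ((qbinom (1/2) n : ℚ) : ℂ) =
      PowerSeries.trunc N B := by
    ext n
    rw [PowerSeries.coeff_trunc, hB, PowerSeries.binomialSeries_coeff, ← qbinom_eq_choose,
      Rat.smul_one_eq_cast]
    simp [Polynomial.coeff_monomial]
  rw [X_pow_dvd_iff, htrunc]
  intro d hd
  have h := PowerSeries.coeff_mul_eq_coeff_trunc_mul_trunc B B hd
  rw [hsq] at h
  rw [← Polynomial.coe_mul, Polynomial.coeff_coe] at h
  rw [coeff_sub, sub_eq_zero, sq, ← h]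
  simp [PowerSeries.coeff_X, Polynomial.coeff_X, PowerSeries.coeff_one, Polynomial.coeff_one,
    eq_comm]

section Series

variable {A : Type*} [Ring A]

theorem coeff_pow_mul_eq_zero {Y : PowerSeries A} (hY : PowerSeries.constantCoeff Y = 0)
    {m n : ℕ} (h : m < n) (Z : PowerSeries A) : PowerSeries.coeff m (Y ^ n * Z) = 0 := by
  obtain ⟨W, rfl⟩ := PowerSeries.X_dvd_iff.2 hY
  rw [(PowerSeries.commute_X W).symm.mul_pow, mul_assoc, PowerSeries.coeff_X_pow_mul',
    if_neg (by omega)]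

/-- A series agreeing coefficientwise with `Σ binom(1/2,n) Yⁿ` is a square root of `1 + Y`. -/
theorem mul_self_eq_one_add [Algebra ℂ A] {Y P : PowerSeries A} (hY : PowerSeries.constantCoeff Y = 0)
    (hP : ∀ m, PowerSeries.coeff m P = PowerSeries.coeff m
      (∑ n ∈ Finset.range (m + 1), ((qbinom (1/2) n : ℚ) : ℂ) • Y ^ n)) :
    P * P = 1 + Y := by
  ext m
  set p : Polynomial ℂ :=
    ∑ n ∈ Finset.range (m + 1), Polynomial.monomial n ((qbinom (1/2) n : ℚ) : ℂ) with hp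
  have hcoeff : ∀ k ≤ m, PowerSeries.coeff k P = PowerSeries.coeff k (Polynomial.aeval Y p) := by
    intro k hk
    rw [hP, hp, map_sum, map_sum, map_sum]
    refine Finset.sum_subset_zero_on_sdiff (Finset.range_mono (by omega)) ?_ ?_
    · intro n hn
      simp only [Finset.mem_sdiff, Finset.mem_range] at hn
      rw [Polynomial.aeval_monomial, Algebra.commutes]
      exact coeff_pow_mul_eq_zero hY (by omega) _
    · intro n _
      rw [Polynomial.aeval_monomial, Algebra.smul_def]
  have hmul : PowerSeries.coeff m (P * P) =
      PowerSeries.coeff m (Polynomial.aeval Y p * Polynomial.aeval Y p) := by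
    rw [PowerSeries.coeff_mul, PowerSeries.coeff_mul]
    refine Finset.sum_congr rfl fun ij hij => ?_
    have := Finset.HasAntidiagonal.mem_antidiagonal.1 hij
    rw [hcoeff _ (by omega), hcoeff _ (by omega)]
  obtain ⟨r, hr⟩ := X_pow_dvd_sq_sum_qbinom_half (m + 1)
  have hsq : p * p = 1 + Polynomial.X + Polynomial.X ^ (m + 1) * r := by
    rw [← hr, ← hp]; ring
  rw [hmul, ← map_mul, hsq, map_add, map_mul, map_pow, Polynomial.aeval_X, map_add, map_add,
    map_one, Polynomial.aeval_X, coeff_pow_mul_eq_zero hY (Nat.lt_succ_self m), add_zero, map_add]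

theorem commute_C_of_coeff {a : A} {P : PowerSeries A}
    (h : ∀ m, Commute (PowerSeries.coeff m P) a) : Commute P (PowerSeries.C a) := by
  ext m
  rw [PowerSeries.coeff_mul_C, PowerSeries.coeff_C_mul]
  exact h m

theorem Commute.coeff_left {a : A} {P : PowerSeries A} (h : Commute P (PowerSeries.C a))
    (m : ℕ) : Commute (PowerSeries.coeff m P) a := by
  have := congrArg (PowerSeries.coeff m) h.eq
  rwa [PowerSeries.coeff_mul_C, PowerSeries.coeff_C_mul] at this

end Series

namespace Usl3

theorem e₃_eq : e₃ = ι (single 0 2 (by decide) (1 : ℂ)) := by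
  have h : ⁅single (0 : Fin 3) 1 (by decide) (1 : ℂ), single (1 : Fin 3) 2 (by decide) (1 : ℂ)⁆ =
      single 0 2 (by decide) (1 : ℂ) := by
    ext1
    simp [Ring.lie_def]
  rw [← h, LieHom.map_lie, Ring.lie_def, e₃, e₁, e₂]

theorem commute_ι_of_lie_eq_zero {x y : sl (Fin 3) ℂ} (h : ⁅x, y⁆ = 0) : Commute (ι x) (ι y) := by
  rw [commute_iff_lie_eq, ← LieHom.map_lie, h, map_zero]

theorem commute_e₃_e₁ : Commute e₃ e₁ := by
  rw [e₃_eq]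
  refine commute_ι_of_lie_eq_zero ?_
  ext1
  simp [Ring.lie_def]

theorem commute_e₃_e₂ : Commute e₃ e₂ := by
  rw [e₃_eq]
  refine commute_ι_of_lie_eq_zero ?_
  ext1
  simp [Ring.lie_def]

theorem S_mul_self : S * S = 1 + (PowerSeries.X * PowerSeries.C e₃) ^ 2 := by
  refine mul_self_eq_one_add (by simp) fun m => ?_
  have hpow : ∀ n : ℕ, ((PowerSeries.X * PowerSeries.C e₃) ^ 2) ^ n =
      PowerSeries.X ^ (2 * n) * PowerSeries.C (e₃ ^ (2 * n)) := by
    intro n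
    rw [← pow_mul, (PowerSeries.commute_X _).symm.mul_pow, map_pow]
  have hterm : ∀ n : ℕ, PowerSeries.coeff m (((qbinom (1/2) n : ℚ) : ℂ) •
      ((PowerSeries.X * PowerSeries.C e₃) ^ 2) ^ n) =
      if m = 2 * n then ((qbinom (1/2) n : ℚ) : ℂ) • e₃ ^ m else 0 := by
    intro n
    rw [hpow, PowerSeries.coeff_smul, PowerSeries.coeff_mul_C, PowerSeries.coeff_X_pow]
    split_ifs with h
    · rw [one_mul, h]
    · rw [zero_mul, smul_zero]
  rw [map_sum, Finset.sum_congr rfl fun n _ => hterm n, S, PowerSeries.coeff_mk]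
  split_ifs with h
  · rw [Finset.sum_eq_single (m / 2)]
    · rw [if_pos (by omega)]
    · intro n _ hn
      rw [if_neg (by omega)]
    · intro hn
      exact absurd (Finset.mem_range.2 (by omega)) hn
  · refine (Finset.sum_eq_zero fun n _ => ?_).symm
    rw [if_neg (by omega)]

theorem commute_S {a : Usl3} (ha : Commute e₃ a) : Commute S (PowerSeries.C a) := by
  refine commute_C_of_coeff fun m => ?_
  rw [S, PowerSeries.coeff_mk]
  split_ifs
  · exact (ha.pow_left m).smul_left _
  · exact Commute.zero_left a

theorem commute_T {a : Usl3} (ha : Commute e₃ a) : Commute T (PowerSeries.C a) :=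
  ((PowerSeries.commute_X _).symm.mul_left (ha.map PowerSeries.C)).add_left (commute_S ha)

theorem commute_Thalf {a : Usl3} (ha : Commute e₃ a) : Commute Thalf (PowerSeries.C a) := by
  refine commute_C_of_coeff fun m => ?_
  rw [Thalf, Tpow, PowerSeries.coeff_mk]
  refine Commute.coeff_left (Commute.sum_left _ _ _ fun n _ => ?_) m
  exact (((commute_T ha).sub_left (Commute.one_left _)).pow_left n).smul_left _

theorem Thalf_mul_self : Thalf * Thalf = T := by
  rw [mul_self_eq_one_add (Y := T - 1) (P := Thalf) _ fun m => by rw [Thalf, Tpow, PowerSeries.coeff_mk],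
    add_sub_cancel]
  rw [← PowerSeries.coeff_zero_eq_constantCoeff_apply]
  simp [T, S, qbinom]

theorem T_sq_sub_one : T ^ 2 - 1 = 2 * (PowerSeries.X * (T * PowerSeries.C e₃)) := by
  have hS := S_mul_self
  have hx : PowerSeries.X * (T * PowerSeries.C e₃) = T * (PowerSeries.X * PowerSeries.C e₃) := by
    rw [← mul_assoc, PowerSeries.X_mul, mul_assoc]
  have hc : Commute S (PowerSeries.X * PowerSeries.C e₃) :=
    (PowerSeries.commute_X S).mul_right (commute_S (Commute.refl e₃))
  rw [hx, T]
  generalize PowerSeries.X * PowerSeries.C e₃ = x at hS hc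
  have hc' := hc.eq
  have : (x + S) ^ 2 - 1 = x * x + x * S + S * x + (S * S - 1) := by noncomm_ring
  rw [this, hS, ← hc']
  noncomm_ring

theorem C_e₃ : PowerSeries.C e₃ =
    PowerSeries.C e₁ * PowerSeries.C e₂ - PowerSeries.C e₂ * PowerSeries.C e₁ := by
  rw [e₃, map_sub, map_mul, map_mul]

end Usl3

/-- If `p` commutes with `a`, `b`, and `a` commutes with `ab - ba`, then `pa`, `pb` satisfy the
Serre relation. -/
theorem serre_of_commute {A : Type*} [Ring A] {p a b : A} (hpa : Commute p a) (hpb : Commute p b)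
    (h : Commute (a * b - b * a) a) :
    (p * a) ^ 2 * (p * b) - 2 * (p * a * (p * b) * (p * a)) + p * b * (p * a) ^ 2 = 0 := by
  have hmul : ∀ {x y : A}, Commute p x → p * x * (p * y) = p * p * (x * y) := fun hx =>
    hx.symm.mul_mul_mul_comm _ _
  have h3 : ∀ {x y z : A}, Commute p x → Commute p y →
      p * x * (p * y) * (p * z) = p * p * p * (x * y * z) := by
    intro x y z hx hy
    rw [hmul hx, mul_assoc (p * p), ← mul_assoc (x * y), ← (hx.mul_right hy).eq]
    simp only [mul_assoc]
  rw [sq, h3 hpa hpa, h3 hpa hpb, ← mul_assoc (p * b), h3 hpb hpa]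
  have key : a * a * b - 2 * (a * b * a) + b * a * a = 0 := by
    have h0 := sub_eq_zero.2 h.eq
    rw [← neg_eq_zero, ← h0]
    noncomm_ring
  rw [← mul_zero (p * p * p), ← key]
  noncomm_ring

open Usl3 in
/-- In `R = U(sl(3,ℂ))[[h]]` (Jordanian deformation of `sl(3)`):
`2h(E₁E₂ - E₂E₁) = T² - 1` and the Serre relations for `E₁, E₂`. -/
theorem statement_6 :
    (2 : ℂ) • (PowerSeries.X * (E₁ * E₂ - E₂ * E₁)) = T ^ 2 - 1 ∧
    E₁ ^ 2 * E₂ - 2 * (E₁ * E₂ * E₁) + E₂ * E₁ ^ 2 = 0 ∧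
    E₂ ^ 2 * E₁ - 2 * (E₂ * E₁ * E₂) + E₁ * E₂ ^ 2 = 0 := by
  have h₁ := commute_Thalf commute_e₃_e₁
  have h₂ := commute_Thalf commute_e₃_e₂
  refine ⟨?_, serre_of_commute h₁ h₂ ?_, serre_of_commute h₂ h₁ ?_⟩
  · have hE : E₁ * E₂ - E₂ * E₁ = T * PowerSeries.C e₃ := by
      rw [E₁, E₂, h₁.symm.mul_mul_mul_comm, h₂.symm.mul_mul_mul_comm, Thalf_mul_self, ← mul_sub,
        C_e₃]
    rw [hE, T_sq_sub_one, two_smul, two_mul]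
  · rw [← C_e₃]
    exact commute_e₃_e₁.map PowerSeries.C
  · rw [← neg_sub, ← C_e₃]
    exact (commute_e₃_e₂.map PowerSeries.C).neg_left
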